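/- Let c = 12√2. For every projection angle θ ∈ [0, π) and every k ≥ 1, the expected projection lengths D_k := 𝔼[|proj_θ 𝒟_k(ω)|] (expectation over the i.i.d. uniform angle tree of height k) satisfy the recursive inequality D_{k+1} ≤ D_k − c^{-1} · D_k². -/

import Mathlib

open MeasureTheory Real Set

noncomputable section

/-- The uniform probability measure on the interval `[0, π/2]`. -/
def unif : Measure ℝ := (ENNReal.ofReal (π / 2))⁻¹ • volume.restrict (Set.Icc 0 (π / 2))

/-- An angle tree of height `n`: an angle in `ℝ` for every word over `{0,1,2,3}`
of length `< n`. -/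
abbrev AngleTree (n : ℕ) := ∀ k : Fin n, (Fin k → Fin 4) → ℝ

/-- The i.i.d. measure on angle trees of height `n`, each coordinate uniform on `[0, π/2]`. -/
def treeMeasure (n : ℕ) : Measure (AngleTree n) :=
  Measure.pi fun k => Measure.pi fun _ : Fin k → Fin 4 => unif

/-- The centre `c(ω, w)` of the disk indexed by the word `w` of length `n`. -/
def center {n : ℕ} (ω : AngleTree n) (w : Fin n → Fin 4) : ℂ :=
  ∑ k : Fin n, (3 / 4 : ℂ) * (4 : ℂ)⁻¹ ^ (k : ℕ) *
    Complex.exp (((((w k : ℕ) : ℝ) * (π / 2) -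
      ω k (fun i => w (Fin.castLE k.isLt.le i)) : ℝ) : ℂ) * Complex.I)

/-- The `n`-th generation random Cantor disks `𝒟_n(ω)`. -/
def cantorDisks {n : ℕ} (ω : AngleTree n) : Set ℂ :=
  ⋃ w : Fin n → Fin 4, Metric.closedBall (center ω w) ((4 : ℝ)⁻¹ ^ n)

/-- The orthogonal projection of `E ⊆ ℂ` onto the line `ℝ·e^{iθ}`, identified with `ℝ`. -/
def proj (θ : ℝ) (E : Set ℂ) : Set ℝ :=
  (fun z => (Complex.exp (-(θ : ℂ) * Complex.I) * z).re) '' E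

/-- The length of the projection of `E` in direction `θ`. -/
def projLen (θ : ℝ) (E : Set ℂ) : ℝ := (volume (proj θ E)).toReal

open scoped ENNReal

instance isProbabilityMeasure_unif : IsProbabilityMeasure unif := by
  constructor
  have h : ENNReal.ofReal (π / 2) ≠ 0 := by simp [Real.pi_pos]
  simp only [unif, Measure.smul_apply, Measure.restrict_apply_univ, Real.volume_Icc, sub_zero,
    smul_eq_mul]
  exact ENNReal.inv_mul_cancel h ENNReal.ofReal_ne_top

instance isProbabilityMeasure_treeMeasure (n : ℕ) : IsProbabilityMeasure (treeMeasure n) := by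
  unfold treeMeasure; infer_instance

/-- The angle tree with root angle `α` whose four subtrees are the `T j`. -/
def graft {n : ℕ} (α : ℝ) (T : Fin 4 → AngleTree n) : AngleTree (n + 1) :=
  Fin.cons (α := fun k : Fin (n + 1) => (Fin k → Fin 4) → ℝ) (fun _ => α)
    (fun i w => T (w (0 : Fin (i + 1))) i (fun l => w l.succ))

lemma graft_zero {n : ℕ} (α : ℝ) (T : Fin 4 → AngleTree n) (w : Fin (0 : Fin (n + 1)) → Fin 4) :
    graft α T 0 w = α := rfl

lemma graft_succ {n : ℕ} (α : ℝ) (T : Fin 4 → AngleTree n) (i : Fin n)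
    (w : Fin i.succ → Fin 4) :
    graft α T i.succ w = T (w (0 : Fin (i + 1))) i (fun l => w l.succ) := rfl

lemma measurable_graft (n : ℕ) :
    Measurable fun q : ℝ × (Fin 4 → AngleTree n) => graft q.1 q.2 := by
  refine measurable_pi_iff.2 fun k => measurable_pi_iff.2 fun w => ?_
  cases k using Fin.cases with
  | zero => simp only [graft_zero]; fun_prop
  | succ i => simp only [graft_succ]; fun_prop

/-- A nested product of probability measures is determined by its values on nested boxes. -/
lemma pi_pi_eq_of_boxes {ι : Type*} [Fintype ι] {κ : ι → Type*} [∀ i, Fintype (κ i)]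
    {Ω : Type*} [MeasurableSpace Ω] (μ : Measure Ω) [IsProbabilityMeasure μ]
    {ν : Measure (∀ i, κ i → Ω)}
    (h : ∀ s : ∀ i, κ i → Set Ω, (∀ i j, MeasurableSet (s i j)) →
      ν (univ.pi fun i => univ.pi (s i)) = ∏ i, ∏ j, μ (s i j)) :
    (Measure.pi fun i => Measure.pi fun _ : κ i => μ) = ν := by
  refine Measure.pi_eq_generateFrom (fun i => generateFrom_pi) (fun i => isPiSystem_pi)
    (fun i => ⟨fun _ => univ, fun _ => ⟨fun _ => univ, fun _ _ => MeasurableSet.univ, pi_univ _⟩,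
      fun _ => measure_lt_top _ _, iUnion_const _⟩) ?_
  intro s hs
  choose t ht hts using hs
  obtain rfl : (fun i => univ.pi (t i)) = s := funext hts
  rw [h t fun i j => ht i j (mem_univ j)]
  simp [Measure.pi_pi]

lemma preimage_graft_box {n : ℕ} (s : ∀ k : Fin (n + 1), (Fin k → Fin 4) → Set ℝ) :
    (fun q : ℝ × (Fin 4 → AngleTree n) => graft q.1 q.2) ⁻¹'
        (univ.pi fun k => univ.pi (s k)) =
      s 0 Fin.elim0 ×ˢ univ.pi fun j => univ.pi fun i : Fin n => univ.pi fun w : Fin i → Fin 4 =>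
        s i.succ (Fin.cons (α := fun _ : Fin (i + 1) => Fin 4) j w) := by
  ext ⟨α, T⟩
  simp only [mem_preimage, mem_univ_pi, mem_prod]
  constructor
  · intro h
    refine ⟨h 0 _, fun j i w => ?_⟩
    simpa [graft_succ] using h i.succ (Fin.cons (α := fun _ : Fin (i + 1) => Fin 4) j w)
  · rintro ⟨h0, h1⟩ k w
    cases k using Fin.cases with
    | zero =>
      obtain rfl : w = Fin.elim0 := funext fun l => l.elim0
      exact h0
    | succ i =>
      have := h1 (w (0 : Fin (i + 1))) i (fun l => w l.succ)
      rw [graft_succ]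
      convert this
      exact (Fin.cons_self_tail (α := fun _ : Fin (i + 1) => Fin 4) w).symm

/-- A random angle tree of height `n + 1` is a uniform root angle with four independent random
subtrees of height `n`. -/
lemma map_graft (n : ℕ) :
    (unif.prod (Measure.pi fun _ : Fin 4 => treeMeasure n)).map (fun q => graft q.1 q.2) =
      treeMeasure (n + 1) := by
  refine (pi_pi_eq_of_boxes unif fun s hs => ?_).symm
  rw [Measure.map_apply (measurable_graft n) (MeasurableSet.univ_pi fun k =>
    MeasurableSet.univ_pi fun w => hs k w), preimage_graft_box, Measure.prod_prod, Measure.pi_pi,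
    Fin.prod_univ_succ (n := n)]
  refine congrArg₂ (· * ·) ?_ ?_
  · exact (Fintype.prod_unique (ι := Fin 0 → Fin 4) fun w => unif (s 0 w)).symm
  · simp only [treeMeasure, Measure.pi_pi]
    rw [Finset.prod_comm]
    refine Finset.prod_congr rfl fun i _ => ?_
    rw [← Fintype.prod_prod_type']
    exact Fintype.prod_equiv (Fin.consEquiv fun _ : Fin (i + 1) => Fin 4) _ _ fun _ => rfl

/-- The projection of `center ω w` in direction `θ`. -/
def projCenter (θ : ℝ) {n : ℕ} (ω : AngleTree n) (w : Fin n → Fin 4) : ℝ :=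
  ∑ k : Fin n, 3 / 4 * (4 : ℝ)⁻¹ ^ (k : ℕ) *
    Real.cos (((w k : ℕ) : ℝ) * (π / 2) - ω k (fun i => w (Fin.castLE k.isLt.le i)) - θ)

lemma re_exp_mul_center (θ : ℝ) {n : ℕ} (ω : AngleTree n) (w : Fin n → Fin 4) :
    (Complex.exp (-(θ : ℂ) * Complex.I) * center ω w).re = projCenter θ ω w := by
  simp only [_root_.center, projCenter, Finset.mul_sum, Complex.re_sum]
  refine Finset.sum_congr rfl fun k _ => ?_
  rw [mul_left_comm, ← Complex.exp_add, ← add_mul, ← Complex.ofReal_neg, ← Complex.ofReal_add]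
  have h : (3 / 4 : ℂ) * (4 : ℂ)⁻¹ ^ (k : ℕ) = ((3 / 4 * (4 : ℝ)⁻¹ ^ (k : ℕ) : ℝ) : ℂ) := by
    push_cast; rfl
  rw [h, Complex.re_ofReal_mul, Complex.exp_ofReal_mul_I_re, neg_add_eq_sub]

lemma mem_proj_cantorDisks {θ : ℝ} {n : ℕ} {ω : AngleTree n} {x : ℝ} :
    x ∈ proj θ (cantorDisks ω) ↔ ∃ w, |x - projCenter θ ω w| ≤ (4 : ℝ)⁻¹ ^ n := by
  simp only [proj, cantorDisks, image_iUnion, mem_iUnion, mem_image, Metric.mem_closedBall,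
    Complex.dist_eq]
  refine exists_congr fun w => ?_
  have hnorm : ‖Complex.exp (-(θ : ℂ) * Complex.I)‖ = 1 := by
    rw [← Complex.ofReal_neg, Complex.norm_exp_ofReal_mul_I]
  constructor
  · rintro ⟨z, hz, rfl⟩
    rw [← re_exp_mul_center, ← Complex.sub_re, ← mul_sub]
    refine (Complex.abs_re_le_norm _).trans ?_
    rwa [norm_mul, hnorm, one_mul]
  · intro hx
    refine ⟨center ω w + Complex.exp (θ * Complex.I) * ((x - projCenter θ ω w : ℝ) : ℂ), ?_, ?_⟩
    · rw [add_sub_cancel_left, norm_mul, Complex.norm_exp_ofReal_mul_I, one_mul, Complex.norm_real]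
      exact hx
    · rw [mul_add, Complex.add_re, re_exp_mul_center, ← mul_assoc, ← Complex.exp_add]
      simp

lemma abs_projCenter_le (θ : ℝ) {n : ℕ} (ω : AngleTree n) (w : Fin n → Fin 4) :
    |projCenter θ ω w| ≤ 1 - (4 : ℝ)⁻¹ ^ n := by
  have hsum : ∀ n : ℕ, ∑ k ∈ Finset.range n, 3 / 4 * (4 : ℝ)⁻¹ ^ k = 1 - (4 : ℝ)⁻¹ ^ n := by
    intro n
    induction n with
    | zero => simp
    | succ n ih => rw [Finset.sum_range_succ, ih, pow_succ]; ring
  rw [← hsum, ← Fin.sum_univ_eq_sum_range fun k => 3 / 4 * (4 : ℝ)⁻¹ ^ k]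
  refine (Finset.abs_sum_le_sum_abs _ _).trans (Finset.sum_le_sum fun k _ => ?_)
  rw [abs_mul, abs_of_nonneg (by positivity : 0 ≤ 3 / 4 * (4 : ℝ)⁻¹ ^ (k : ℕ))]
  exact mul_le_of_le_one_right (by positivity) (Real.abs_cos_le_one _)

lemma abs_le_one_of_mem_proj {θ : ℝ} {n : ℕ} {ω : AngleTree n} {x : ℝ}
    (hx : x ∈ proj θ (cantorDisks ω)) : |x| ≤ 1 := by
  obtain ⟨w, hw⟩ := mem_proj_cantorDisks.1 hx
  have h := abs_projCenter_le θ ω w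
  have h' := abs_add_le (x - projCenter θ ω w) (projCenter θ ω w)
  rw [sub_add_cancel] at h'
  linarith

lemma measurableSet_mem_proj (θ : ℝ) (n : ℕ) :
    MeasurableSet {q : AngleTree n × ℝ | q.2 ∈ proj θ (cantorDisks q.1)} := by
  simp only [mem_proj_cantorDisks, ofPred_exists, projCenter]
  refine MeasurableSet.iUnion fun w => measurableSet_le ?_ measurable_const
  fun_prop

/-- The projection of the centre of the `j`-th first-generation disk when the root angle is `α`. -/
def offset (θ α : ℝ) (j : Fin 4) : ℝ :=
  3 / 4 * Real.cos (((j : ℕ) : ℝ) * (π / 2) - α - θ)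

lemma projCenter_graft (θ α : ℝ) {n : ℕ} (T : Fin 4 → AngleTree n) (j : Fin 4)
    (w : Fin n → Fin 4) :
    projCenter θ (graft α T) (Fin.cons (α := fun _ : Fin (n + 1) => Fin 4) j w) =
      offset θ α j + 4⁻¹ * projCenter θ (T j) w := by
  simp only [projCenter, offset]
  rw [Fin.sum_univ_succ, Finset.mul_sum]
  congr 1
  · have h : graft α T 0 (fun l => (Fin.cons (α := fun _ : Fin (n + 1) => Fin 4) j w)
        (Fin.castLE (0 : Fin (n + 1)).isLt.le l)) = α := rfl
    rw [h]
    simp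
  · refine Finset.sum_congr rfl fun i _ => ?_
    have h : graft α T i.succ (fun l => (Fin.cons (α := fun _ : Fin (n + 1) => Fin 4) j w)
        (Fin.castLE i.succ.isLt.le l)) = T j i (fun l => w (Fin.castLE i.isLt.le l)) := rfl
    rw [h, Fin.cons_succ, Fin.val_succ, pow_succ]
    ring

lemma mem_proj_graft {θ α x : ℝ} {n : ℕ} {T : Fin 4 → AngleTree n} :
    x ∈ proj θ (cantorDisks (graft α T)) ↔
      ∃ j, 4 * (x - offset θ α j) ∈ proj θ (cantorDisks (T j)) := by
  simp only [mem_proj_cantorDisks]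
  rw [(Fin.consEquiv fun _ : Fin (n + 1) => Fin 4).surjective.exists, Prod.exists]
  refine exists_congr fun j => exists_congr fun w => ?_
  have h : x - projCenter θ (graft α T) (Fin.consEquiv (fun _ : Fin (n + 1) => Fin 4) (j, w)) =
      4⁻¹ * (4 * (x - offset θ α j) - projCenter θ (T j) w) := by
    refine (congrArg (x - ·) (projCenter_graft θ α T j w)).trans ?_
    ring
  rw [h, abs_mul, abs_of_pos (by norm_num : (0 : ℝ) < 4⁻¹), pow_succ']
  exact mul_le_mul_iff_right₀ (by norm_num)

/-- The probability that the projection of the `n`-th generation disks contains `x`. -/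
def hitProb (θ : ℝ) (n : ℕ) (x : ℝ) : ℝ≥0∞ :=
  treeMeasure n {ω | x ∈ proj θ (cantorDisks ω)}

/-- The expected projection length, as an extended nonnegative real. -/
def meanLen (θ : ℝ) (n : ℕ) : ℝ≥0∞ :=
  ∫⁻ ω, volume (proj θ (cantorDisks ω)) ∂treeMeasure n

/-- The autocorrelation function of `hitProb`. -/
def autocorr (θ : ℝ) (n : ℕ) (s : ℝ) : ℝ≥0∞ :=
  ∫⁻ y, hitProb θ n y * hitProb θ n (y + s)

lemma measurable_hitProb (θ : ℝ) (n : ℕ) : Measurable (hitProb θ n) :=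
  measurable_measure_prodMk_right (measurableSet_mem_proj θ n)

lemma measurable_autocorr (θ : ℝ) (n : ℕ) : Measurable (autocorr θ n) := by
  have h := measurable_hitProb θ n
  refine Measurable.lintegral_prod_right' (f := fun q : ℝ × ℝ =>
    hitProb θ n q.2 * hitProb θ n (q.2 + q.1)) ?_
  fun_prop

lemma measurableSet_proj (θ : ℝ) {n : ℕ} (ω : AngleTree n) :
    MeasurableSet (proj θ (cantorDisks ω)) :=
  measurable_prodMk_left (measurableSet_mem_proj θ n)

lemma lintegral_hitProb (θ : ℝ) (n : ℕ) : ∫⁻ x, hitProb θ n x = meanLen θ n :=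
  (Measure.prod_apply_symm (measurableSet_mem_proj θ n)).symm.trans
    (Measure.prod_apply (measurableSet_mem_proj θ n))

lemma hitProb_eq_zero {θ : ℝ} {n : ℕ} {x : ℝ} (hx : 1 < |x|) : hitProb θ n x = 0 := by
  have h : {ω : AngleTree n | x ∈ proj θ (cantorDisks ω)} = ∅ :=
    eq_empty_of_forall_notMem fun ω hω => hx.not_ge (abs_le_one_of_mem_proj hω)
  rw [hitProb, h, measure_empty]

lemma volume_proj_le (θ : ℝ) {n : ℕ} (ω : AngleTree n) :
    volume (proj θ (cantorDisks ω)) ≤ 2 := by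
  have h : proj θ (cantorDisks ω) ⊆ Icc (-1) 1 := fun x hx => abs_le.1 (abs_le_one_of_mem_proj hx)
  refine (measure_mono h).trans_eq ?_
  rw [Real.volume_Icc]
  norm_num

lemma meanLen_ne_top (θ : ℝ) (n : ℕ) : meanLen θ n ≠ ∞ := by
  refine ne_top_of_le_ne_top (b := 2) (by simp) ?_
  refine (lintegral_mono fun ω => volume_proj_le θ ω).trans ?_
  simp

lemma integral_projLen (θ : ℝ) (n : ℕ) :
    ∫ ω, projLen θ (cantorDisks ω) ∂treeMeasure n = (meanLen θ n).toReal :=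
  integral_toReal (measurable_measure_prodMk_left (measurableSet_mem_proj θ n)).aemeasurable
    (Filter.Eventually.of_forall fun ω => (volume_proj_le θ ω).trans_lt (by simp))

lemma autocorr_neg (θ : ℝ) (n : ℕ) (s : ℝ) : autocorr θ n (-s) = autocorr θ n s := by
  rw [autocorr, ← lintegral_add_right_eq_self _ s]
  simp only [add_neg_cancel_right, autocorr, mul_comm]

lemma autocorr_eq_zero {θ : ℝ} {n : ℕ} {s : ℝ} (hs : 2 < |s|) : autocorr θ n s = 0 := by
  refine (lintegral_congr fun y => ?_).trans lintegral_zero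
  rcases lt_or_ge 1 |y| with hy | hy
  · rw [hitProb_eq_zero hy, zero_mul]
  · have h := abs_sub (y + s) y
    rw [add_sub_cancel_left] at h
    rw [hitProb_eq_zero (x := y + s) (by linarith), mul_zero]

lemma lintegral_autocorr (θ : ℝ) (n : ℕ) : ∫⁻ s, autocorr θ n s = meanLen θ n ^ 2 := by
  have h := measurable_hitProb θ n
  unfold autocorr
  rw [lintegral_lintegral_swap (by fun_prop)]
  have : ∀ y, ∫⁻ s, hitProb θ n y * hitProb θ n (y + s) = hitProb θ n y * meanLen θ n := by
    intro y
    rw [lintegral_const_mul _ (by fun_prop), lintegral_add_left_eq_self (hitProb θ n) y,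
      lintegral_hitProb]
  simp_rw [this]
  rw [lintegral_mul_const _ h, lintegral_hitProb, sq]

/-- The projection of the part of the disks descending from the `j`-th first-generation disk, with
root angle `α` and subtree `ω`. -/
def piece (θ α : ℝ) (j : Fin 4) {n : ℕ} (ω : AngleTree n) : Set ℝ :=
  {x | 4 * (x - offset θ α j) ∈ proj θ (cantorDisks ω)}

lemma proj_graft (θ α : ℝ) {n : ℕ} (T : Fin 4 → AngleTree n) :
    proj θ (cantorDisks (graft α T)) = ⋃ j, piece θ α j (T j) := by
  ext x
  rw [mem_proj_graft, mem_iUnion]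
  rfl

lemma measurableSet_mem_piece (θ : ℝ) (n : ℕ) (j : Fin 4) :
    MeasurableSet {q : (ℝ × (Fin 4 → AngleTree n)) × ℝ | q.2 ∈ piece θ q.1.1 j (q.1.2 j)} := by
  have h : Measurable fun q : (ℝ × (Fin 4 → AngleTree n)) × ℝ =>
      (q.1.2 j, 4 * (q.2 - offset θ q.1.1 j)) := by
    unfold offset
    fun_prop
  exact h (measurableSet_mem_proj θ n)

lemma measurableSet_piece (θ α : ℝ) (j : Fin 4) {n : ℕ} (ω : AngleTree n) :
    MeasurableSet (piece θ α j ω) := by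
  have h : Measurable fun x : ℝ => 4 * (x - offset θ α j) := by fun_prop
  exact h (measurableSet_proj θ ω)

lemma map_four_mul_sub (t : ℝ) :
    (volume : Measure ℝ).map (fun x => 4 * (x - t)) = (4 : ℝ≥0∞)⁻¹ • volume := by
  have h : (fun x : ℝ => 4 * (x - t)) = (fun x => 4 * x) ∘ fun x => x - t := rfl
  rw [h, ← Measure.map_map (by fun_prop) (by fun_prop),
    (measurePreserving_sub_right volume t).map_eq, Real.map_volume_mul_left (by norm_num)]
  congr 1
  rw [abs_of_pos (by norm_num), ENNReal.ofReal_inv_of_pos (by norm_num)]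
  norm_num

lemma volume_piece (θ α : ℝ) (j : Fin 4) {n : ℕ} (ω : AngleTree n) :
    volume (piece θ α j ω) = 4⁻¹ * volume (proj θ (cantorDisks ω)) := by
  rw [← smul_eq_mul, ← Measure.smul_apply, ← map_four_mul_sub (offset θ α j),
    Measure.map_apply (by fun_prop) (measurableSet_proj θ ω)]
  rfl

lemma lintegral_volume_piece (θ α : ℝ) (n : ℕ) (j : Fin 4) :
    ∫⁻ T, volume (piece θ α j (T j)) ∂(Measure.pi fun _ : Fin 4 => treeMeasure n) =
      4⁻¹ * meanLen θ n := by
  have hm : Measurable fun ω : AngleTree n => volume (proj θ (cantorDisks ω)) :=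
    measurable_measure_prodMk_left (measurableSet_mem_proj θ n)
  simp only [volume_piece]
  rw [lintegral_const_mul' _ _ (by simp), meanLen,
    ← (measurePreserving_eval (fun _ : Fin 4 => treeMeasure n) j).lintegral_comp hm]

lemma pi_pair {ι X : Type*} [Fintype ι] [MeasurableSpace X] (μ : Measure X)
    [IsProbabilityMeasure μ] {i j : ι} (hij : i ≠ j) (U V : Set X) :
    (Measure.pi fun _ : ι => μ) {T | T i ∈ U ∧ T j ∈ V} = μ U * μ V := by
  classical
  have h : {T : ι → X | T i ∈ U ∧ T j ∈ V} =
      Set.pi ({i, j} : Finset ι) (Function.update (fun _ => V) i U) := by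
    ext T
    simp [hij.symm]
  rw [h, Measure.pi_pi_finset, Finset.prod_pair hij]
  simp [hij.symm]

lemma lintegral_volume_inter_piece (θ α : ℝ) (n : ℕ) {i j : Fin 4} (hij : i ≠ j) :
    ∫⁻ T, volume (piece θ α i (T i) ∩ piece θ α j (T j))
        ∂(Measure.pi fun _ : Fin 4 => treeMeasure n) =
      4⁻¹ * autocorr θ n (4 * (offset θ α i - offset θ α j)) := by
  have hE : MeasurableSet {q : (Fin 4 → AngleTree n) × ℝ |
      q.2 ∈ piece θ α i (q.1 i) ∩ piece θ α j (q.1 j)} := by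
    have h : Measurable fun q : (Fin 4 → AngleTree n) × ℝ => ((α, q.1), q.2) := by fun_prop
    exact h ((measurableSet_mem_piece θ n i).inter (measurableSet_mem_piece θ n j))
  have hh := measurable_hitProb θ n
  refine (Measure.prod_apply hE).symm.trans ((Measure.prod_apply_symm hE).trans ?_)
  rw [autocorr, ← smul_eq_mul, ← lintegral_smul_measure, ← map_four_mul_sub (offset θ α i),
    lintegral_map (by fun_prop) (by fun_prop)]
  refine lintegral_congr fun x => ?_
  refine (pi_pair (treeMeasure n) hij {ω | x ∈ piece θ α i ω}
    {ω | x ∈ piece θ α j ω}).trans ?_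
  rw [← mul_add, sub_add_sub_cancel]
  rfl

lemma measure_union_four_add_inter_le {X : Type*} [MeasurableSpace X] (μ : Measure X)
    {a b c d : Set X} (hb : MeasurableSet b) (hd : MeasurableSet d) :
    μ ((a ∪ b) ∪ (c ∪ d)) + (μ (a ∩ b) + μ (c ∩ d)) ≤ (μ a + μ b) + (μ c + μ d) := by
  rw [← measure_union_add_inter a hb, ← measure_union_add_inter c hd, add_add_add_comm]
  gcongr
  exact measure_union_le _ _

lemma offset_zero (θ α : ℝ) : offset θ α 0 = 3 / 4 * Real.cos (α + θ) := by
  rw [offset, ← Real.cos_neg]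
  congr 2
  simp
  ring

lemma offset_one (θ α : ℝ) : offset θ α 1 = 3 / 4 * Real.sin (α + θ) := by
  rw [offset, ← Real.cos_pi_div_two_sub]
  congr 2
  simp
  ring

lemma offset_two (θ α : ℝ) : offset θ α 2 = -offset θ α 0 := by
  rw [offset_zero, offset, ← mul_neg, ← Real.cos_pi_sub]
  congr 2
  simp
  ring

lemma offset_three (θ α : ℝ) : offset θ α 3 = -offset θ α 1 := by
  rw [offset_one, offset, ← Real.cos_pi_div_two_sub, ← mul_neg, ← Real.cos_add_pi]
  congr 2
  simp
  ring

lemma abs_sub_le_of_mem_piece {θ α x : ℝ} {n : ℕ} {i j : Fin 4} {ω ω' : AngleTree n}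
    (hx : x ∈ piece θ α i ω) (hx' : x ∈ piece θ α j ω') :
    |offset θ α i - offset θ α j| ≤ 1 / 2 := by
  have h := abs_le.1 (abs_le_one_of_mem_proj hx)
  have h' := abs_le.1 (abs_le_one_of_mem_proj hx')
  rw [abs_le]
  constructor <;> linarith [h.1, h.2, h'.1, h'.2]

/-- Adjacent disks of the first generation cannot overlap in projection along both of the two
perfect matchings of the square. -/
lemma not_both_overlap (θ α : ℝ) :
    ¬ (|offset θ α 0 - offset θ α 1| ≤ 1 / 2 ∧ |offset θ α 0 + offset θ α 1| ≤ 1 / 2) := by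
  rintro ⟨h1, h2⟩
  have h3 := sq_le_sq' (abs_le.1 h1).1 (abs_le.1 h1).2
  have h4 := sq_le_sq' (abs_le.1 h2).1 (abs_le.1 h2).2
  rw [offset_zero, offset_one] at h3 h4
  nlinarith [Real.sin_sq_add_cos_sq (α + θ)]

lemma volume_proj_graft_add_le (θ α : ℝ) {n : ℕ} (T : Fin 4 → AngleTree n) :
    volume (proj θ (cantorDisks (graft α T))) +
      ((volume (piece θ α 0 (T 0) ∩ piece θ α 1 (T 1)) +
        volume (piece θ α 2 (T 2) ∩ piece θ α 3 (T 3))) +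
      (volume (piece θ α 0 (T 0) ∩ piece θ α 3 (T 3)) +
        volume (piece θ α 1 (T 1) ∩ piece θ α 2 (T 2)))) ≤
      ∑ j, volume (piece θ α j (T j)) := by
  have hU : (⋃ j, piece θ α j (T j)) =
      (piece θ α 0 (T 0) ∪ piece θ α 1 (T 1)) ∪ (piece θ α 2 (T 2) ∪ piece θ α 3 (T 3)) := by
    ext x
    simp [Fin.exists_fin_succ, or_assoc]
  have hm := fun j => measurableSet_piece θ α j (T j)
  rw [proj_graft, hU, Fin.sum_univ_four]
  by_cases h : |offset θ α 0 - offset θ α 1| ≤ 1 / 2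
  · have h' : ¬ |offset θ α 0 + offset θ α 1| ≤ 1 / 2 := fun h' => not_both_overlap θ α ⟨h, h'⟩
    have h03 : piece θ α 0 (T 0) ∩ piece θ α 3 (T 3) = ∅ :=
      eq_empty_of_forall_notMem fun x hx => h' <| by
        simpa [offset_three] using abs_sub_le_of_mem_piece hx.1 hx.2
    have h12 : piece θ α 1 (T 1) ∩ piece θ α 2 (T 2) = ∅ :=
      eq_empty_of_forall_notMem fun x hx => h' <| by
        simpa [offset_two, add_comm] using abs_sub_le_of_mem_piece hx.1 hx.2
    rw [h03, h12, measure_empty, add_zero, add_zero]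
    refine (measure_union_four_add_inter_le volume (hm 1) (hm 3)).trans_eq ?_
    ring
  · have h01 : piece θ α 0 (T 0) ∩ piece θ α 1 (T 1) = ∅ :=
      eq_empty_of_forall_notMem fun x hx => h (abs_sub_le_of_mem_piece hx.1 hx.2)
    have h23 : piece θ α 2 (T 2) ∩ piece θ α 3 (T 3) = ∅ :=
      eq_empty_of_forall_notMem fun x hx => h <| by
        have := abs_sub_le_of_mem_piece hx.1 hx.2
        rwa [offset_two, offset_three, neg_sub_neg, abs_sub_comm] at this
    rw [h01, h23, measure_empty, add_zero, zero_add]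
    have hU' : (piece θ α 0 (T 0) ∪ piece θ α 1 (T 1)) ∪ (piece θ α 2 (T 2) ∪ piece θ α 3 (T 3)) =
        (piece θ α 0 (T 0) ∪ piece θ α 3 (T 3)) ∪
          (piece θ α 1 (T 1) ∪ piece θ α 2 (T 2)) := by
      ext x
      simp only [mem_union]
      tauto
    rw [hU']
    refine (measure_union_four_add_inter_le volume (hm 3) (hm 2)).trans_eq ?_
    ring

/-- The autocorrelation at the (rescaled) signed distance between the projections of two adjacent
first-generation disks in position `φ`. -/
def overlap (θ : ℝ) (n : ℕ) (φ : ℝ) : ℝ≥0∞ :=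
  autocorr θ n (3 * √2 * Real.cos (φ + π / 4))

lemma measurable_overlap (θ : ℝ) (n : ℕ) : Measurable (overlap θ n) := by
  have h := measurable_autocorr θ n
  unfold overlap
  fun_prop

lemma periodic_overlap (θ : ℝ) (n : ℕ) : Function.Periodic (overlap θ n) π := by
  intro φ
  rw [overlap, add_right_comm, Real.cos_add_pi, mul_neg, autocorr_neg, overlap]

lemma three_sqrt_two_mul_cos (φ : ℝ) :
    3 * √2 * Real.cos (φ + π / 4) = 3 * (Real.cos φ - Real.sin φ) := by
  rw [Real.cos_add, Real.cos_pi_div_four, Real.sin_pi_div_four]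
  have h := Real.mul_self_sqrt (show (0 : ℝ) ≤ 2 by norm_num)
  linear_combination (3 / 2 * (Real.cos φ - Real.sin φ)) * h

lemma autocorr_offset_sub (θ α : ℝ) (n : ℕ) :
    autocorr θ n (4 * (offset θ α 0 - offset θ α 1)) = overlap θ n (α + θ) := by
  rw [overlap, three_sqrt_two_mul_cos, offset_zero, offset_one]
  ring_nf

lemma autocorr_offset_add (θ α : ℝ) (n : ℕ) :
    autocorr θ n (4 * (offset θ α 0 + offset θ α 1)) = overlap θ n (α + π / 2 + θ) := by
  rw [overlap, three_sqrt_two_mul_cos, add_right_comm, Real.cos_add_pi_div_two,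
    Real.sin_add_pi_div_two, offset_zero, offset_one, ← autocorr_neg]
  ring_nf

lemma meanLen_succ_add_le (θ : ℝ) (n : ℕ) :
    meanLen θ (n + 1) +
      2⁻¹ * ∫⁻ α, (overlap θ n (α + θ) + overlap θ n (α + π / 2 + θ)) ∂unif ≤ meanLen θ n := by
  set P := unif.prod (Measure.pi fun _ : Fin 4 => treeMeasure n) with hP
  have hm (j : Fin 4) : Measurable fun q : ℝ × (Fin 4 → AngleTree n) =>
      volume (piece θ q.1 j (q.2 j)) :=
    measurable_measure_prodMk_left (measurableSet_mem_piece θ n j)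
  have hmm (i j : Fin 4) : Measurable fun q : ℝ × (Fin 4 → AngleTree n) =>
      volume (piece θ q.1 i (q.2 i) ∩ piece θ q.1 j (q.2 j)) :=
    measurable_measure_prodMk_left
      ((measurableSet_mem_piece θ n i).inter (measurableSet_mem_piece θ n j))
  have hpiece (j : Fin 4) :
      ∫⁻ q, volume (piece θ q.1 j (q.2 j)) ∂P = 4⁻¹ * meanLen θ n := by
    rw [hP, lintegral_prod _ (hm j).aemeasurable]
    simp [lintegral_volume_piece]
  have hinter {i j : Fin 4} (hij : i ≠ j) :
      ∫⁻ q, volume (piece θ q.1 i (q.2 i) ∩ piece θ q.1 j (q.2 j)) ∂P =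
        ∫⁻ α, 4⁻¹ * autocorr θ n (4 * (offset θ α i - offset θ α j)) ∂unif := by
    rw [hP, lintegral_prod _ (hmm i j).aemeasurable]
    simp only [lintegral_volume_inter_piece θ _ n hij]
  have hproj : Measurable fun ω : AngleTree (n + 1) => volume (proj θ (cantorDisks ω)) :=
    measurable_measure_prodMk_left (measurableSet_mem_proj θ (n + 1))
  have hgraft : meanLen θ (n + 1) =
      ∫⁻ q, volume (proj θ (cantorDisks (graft q.1 q.2))) ∂P := by
    rw [meanLen, ← map_graft, lintegral_map hproj (measurable_graft n)]
  have hov := measurable_overlap θ n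
  have key := lintegral_mono (μ := P) fun q => volume_proj_graft_add_le θ q.1 q.2
  have hpg : Measurable fun q : ℝ × (Fin 4 → AngleTree n) =>
      volume (proj θ (cantorDisks (graft q.1 q.2))) := hproj.comp (measurable_graft n)
  rw [lintegral_add_left hpg, ← hgraft,
    lintegral_add_left ((hmm 0 1).fun_add (hmm 2 3)), lintegral_add_left (hmm 0 1),
    lintegral_add_left (hmm 0 3), lintegral_finsetSum _ fun j _ => hm j,
    hinter (by decide), hinter (by decide), hinter (by decide), hinter (by decide)] at key
  simp only [hpiece, Finset.sum_const, Finset.card_univ, Fintype.card_fin, nsmul_eq_mul] at key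
  have h23 (α : ℝ) : autocorr θ n (4 * (offset θ α 2 - offset θ α 3)) = overlap θ n (α + θ) := by
    rw [← autocorr_offset_sub, ← autocorr_neg, offset_two, offset_three]
    ring_nf
  have h03 (α : ℝ) :
      autocorr θ n (4 * (offset θ α 0 - offset θ α 3)) = overlap θ n (α + π / 2 + θ) := by
    rw [← autocorr_offset_add, offset_three, sub_neg_eq_add]
  have h12 (α : ℝ) :
      autocorr θ n (4 * (offset θ α 1 - offset θ α 2)) = overlap θ n (α + π / 2 + θ) := by
    rw [← autocorr_offset_add, offset_two, sub_neg_eq_add, add_comm (offset θ α 1)]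
  simp only [autocorr_offset_sub, h23, h03, h12] at key
  rw [lintegral_const_mul _ (by fun_prop), lintegral_const_mul _ (by fun_prop), ← two_mul,
    ← two_mul, ← mul_add, ← mul_add, ← mul_assoc, ← mul_assoc] at key
  rw [lintegral_add_left (by fun_prop)]
  have e1 : (2 : ℝ≥0∞) * 4⁻¹ = 2⁻¹ := by
    rw [show (4 : ℝ≥0∞) = 2 * 2 by norm_num, ENNReal.mul_inv (by simp) (by simp), ← mul_assoc,
      ENNReal.mul_inv_cancel (by simp) (by simp), one_mul]
  have e2 : ((4 : ℕ) : ℝ≥0∞) * 4⁻¹ = 1 := ENNReal.mul_inv_cancel (by simp) (by simp)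
  rwa [e1, e2, one_mul] at key

lemma lintegral_overlap_ge (θ : ℝ) (n : ℕ) :
    meanLen θ n ^ 2 ≤ ENNReal.ofReal (3 * √2) * ∫⁻ α in Ioc 0 π, overlap θ n (α + θ) := by
  have hper : Function.Periodic (fun α => overlap θ n (α + θ)) π := fun α => by
    simp only [add_right_comm α π θ, periodic_overlap θ n (α + θ)]
  set c := -(θ + π / 4) with hc
  have hshift : ∫⁻ α in Ioc 0 π, overlap θ n (α + θ) =
      ∫⁻ α in Ioc c (c + π), overlap θ n (α + θ) := by
    have h0 := isAddFundamentalDomain_Ioc Real.pi_pos 0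
    rw [zero_add] at h0
    exact h0.setLIntegral_eq (isAddFundamentalDomain_Ioc Real.pi_pos c) _
      hper.map_vadd_zmultiples
  have hderiv : ∀ α ∈ Ioc c (c + π), HasDerivWithinAt
      (fun α => 3 * √2 * Real.cos (α + θ + π / 4))
      (3 * √2 * -Real.sin (α + θ + π / 4)) (Ioc c (c + π)) α := by
    intro α _
    have h := ((hasDerivAt_id α).add_const θ).add_const (π / 4)
    simpa using (h.cos.const_mul (3 * √2)).hasDerivWithinAt
  have hpos : 0 < 3 * √2 := by positivity
  have hinj : InjOn (fun α => 3 * √2 * Real.cos (α + θ + π / 4)) (Ioc c (c + π)) := by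
    intro x hx y hy hxy
    have h := Real.injOn_cos ⟨by linarith [hx.1], by linarith [hx.2]⟩
      ⟨by linarith [hy.1], by linarith [hy.2]⟩ (mul_left_cancel₀ hpos.ne' hxy)
    linarith
  have hsupp : (autocorr θ n).support ⊆
      (fun α => 3 * √2 * Real.cos (α + θ + π / 4)) '' Ioc c (c + π) := by
    intro s hs
    have hs2 : |s| ≤ 2 := not_lt.1 fun h => hs (autocorr_eq_zero h)
    have hlt : 2 < 3 * √2 := by
      have : 1 ≤ √2 := Real.one_le_sqrt.2 (by norm_num)
      linarith
    obtain ⟨h1, h2⟩ := abs_le.1 hs2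
    have hu : s / (3 * √2) < 1 := (div_lt_one hpos).2 (by linarith)
    have hl : -1 ≤ s / (3 * √2) := (le_div_iff₀ hpos).2 (by linarith)
    refine ⟨Real.arccos (s / (3 * √2)) + c, ⟨?_, ?_⟩, ?_⟩
    · linarith [Real.arccos_pos.2 hu]
    · linarith [Real.arccos_le_pi (s / (3 * √2))]
    · have : Real.arccos (s / (3 * √2)) + c + θ + π / 4 = Real.arccos (s / (3 * √2)) := by
        rw [hc]; ring
      simp only [this]
      rw [Real.cos_arccos hl hu.le, mul_div_cancel₀ _ hpos.ne']
  have hov := measurable_overlap θ n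
  rw [← lintegral_autocorr, ← setLIntegral_eq_of_support_subset hsupp,
    lintegral_image_eq_lintegral_abs_deriv_mul measurableSet_Ioc hderiv hinj, hshift,
    ← lintegral_const_mul _ (by fun_prop)]
  refine lintegral_mono fun α => ?_
  simp only [overlap]
  gcongr
  rw [abs_mul, abs_of_pos hpos, abs_neg]
  exact mul_le_of_le_one_right hpos.le (Real.abs_sin_le_one _)

lemma lintegral_unif_overlap (θ : ℝ) (n : ℕ) :
    ∫⁻ α, (overlap θ n (α + θ) + overlap θ n (α + π / 2 + θ)) ∂unif =
      (ENNReal.ofReal (π / 2))⁻¹ * ∫⁻ α in Ioc 0 π, overlap θ n (α + θ) := by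
  have hov := measurable_overlap θ n
  rw [unif, lintegral_smul_measure, smul_eq_mul, ← Measure.restrict_congr_set Ioc_ae_eq_Icc,
    lintegral_add_left (by fun_prop)]
  congr 1
  have hpre : Ioc 0 (π / 2) = (fun α : ℝ => α + π / 2) ⁻¹' Ioc (π / 2) π := by
    rw [preimage_add_const_Ioc]
    congr 1 <;> ring
  have h2 : ∫⁻ α in Ioc 0 (π / 2), overlap θ n (α + π / 2 + θ) =
      ∫⁻ α in Ioc (π / 2) π, overlap θ n (α + θ) := by
    rw [hpre]
    exact (measurePreserving_add_right volume (π / 2)).setLIntegral_comp_preimage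
      measurableSet_Ioc (by fun_prop : Measurable fun α => overlap θ n (α + θ))
  rw [h2, ← lintegral_union measurableSet_Ioc (Ioc_disjoint_Ioc_of_le le_rfl),
    Ioc_union_Ioc_eq_Ioc (by positivity) (by linarith [Real.pi_pos])]

lemma meanLen_succ_add_sq_le (θ : ℝ) (n : ℕ) :
    meanLen θ (n + 1) + ENNReal.ofReal (12 * √2)⁻¹ * meanLen θ n ^ 2 ≤ meanLen θ n := by
  refine le_trans ?_ (meanLen_succ_add_le θ n)
  rw [lintegral_unif_overlap]
  refine add_le_add le_rfl ?_
  refine (mul_le_mul_right (lintegral_overlap_ge θ n) _).trans ?_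
  rw [← mul_assoc, ← mul_assoc]
  refine mul_le_mul' ?_ le_rfl
  have h2 : (2 : ℝ≥0∞)⁻¹ = ENNReal.ofReal 2⁻¹ := by
    rw [ENNReal.ofReal_inv_of_pos (by norm_num)]
    norm_num
  have hs : 0 < √2 := by positivity
  rw [← ENNReal.ofReal_inv_of_pos (by positivity), h2, ← ENNReal.ofReal_mul (by positivity),
    ← ENNReal.ofReal_mul (by positivity)]
  refine ENNReal.ofReal_le_ofReal ?_
  have e1 : (12 * √2)⁻¹ * (3 * √2) = 1 / 4 := by
    field_simp
    norm_num
  have e2 : 2⁻¹ * (π / 2)⁻¹ = 1 / π := by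
    field_simp
  rw [e1, e2]
  exact one_div_le_one_div_of_le Real.pi_pos Real.pi_le_four

/-- With `c = 12√2`, for every projection angle `θ ∈ [0, π)` and every `k ≥ 1`, the
expected projection lengths `D_k = 𝔼[|proj_θ 𝒟_k(ω)|]` satisfy
`D_{k+1} ≤ D_k − c⁻¹ D_k²`. -/
theorem expected_projection_recursive_inequality
    (c : ℝ) (hc : c = 12 * Real.sqrt 2)
    (θ : ℝ) (hθ : θ ∈ Set.Ico (0 : ℝ) π) (k : ℕ) (hk : 1 ≤ k)
    (D : ℕ → ℝ) (hD : ∀ m, D m = ∫ ω, projLen θ (cantorDisks ω) ∂(treeMeasure m)) :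
    D (k + 1) ≤ D k - c⁻¹ * (D k) ^ 2 := by
  have hD' (m : ℕ) : D m = (meanLen θ m).toReal := (hD m).trans (integral_projLen θ m)
  have hsq : ENNReal.ofReal (12 * √2)⁻¹ * meanLen θ k ^ 2 ≠ ∞ :=
    ENNReal.mul_ne_top ENNReal.ofReal_ne_top (ENNReal.pow_ne_top (meanLen_ne_top θ k))
  have h := ENNReal.toReal_mono (meanLen_ne_top θ k) (meanLen_succ_add_sq_le θ k)
  rw [ENNReal.toReal_add (meanLen_ne_top θ (k + 1)) hsq, ENNReal.toReal_mul,
    ENNReal.toReal_ofReal (by positivity), ENNReal.toReal_pow, ← hD', ← hD', ← hc] at h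
  linarith

end
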